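/- arXiv:1106.3235 — 6 statements merged into one kernel-verified Lean document; each statement's English description precedes it below -/
import Mathlib

section
/- Let H = ℂ^{d_1} ⊗ ⋯ ⊗ ℂ^{d_n}, let {(ρ_i, I_i)}_{i=1}^k be an instance of the local consistency problem, and let ρ be a solution of rank r. Let P be the orthogonal projection onto the range of ρ, and for each i let Π_i be the orthogonal projection onto the range of ρ_i. Then the set M = { X a complex matrix on H : P X P = X and Π_i · tr_{I_i^c}(X) · Π_i = 0 for every i = 1,…,k } is a complex linear subspace of the space of matrices on H of dimension at least r² − Σ_{i=1}^k (rank ρ_i)². -/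
open Matrix ComplexOrder

/-- Merge an index assignment on the subsystems in `I` with one on the complement of `I`,
producing a joint index for the full system `ℂ^{d 1} ⊗ ⋯ ⊗ ℂ^{d n}`. -/
noncomputable def mergeIdx {n : ℕ} {d : Fin n → ℕ} (I : Finset (Fin n))
    (x : ∀ a : {a : Fin n // a ∈ I}, Fin (d a.1))
    (c : ∀ a : {a : Fin n // a ∉ I}, Fin (d a.1)) : ∀ a : Fin n, Fin (d a) :=
  fun a => if h : a ∈ I then x ⟨a, h⟩ else c ⟨a, h⟩

/-- The partial trace over the complement `Iᶜ`, keeping the subsystems in `I`: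
`(tr_{Iᶜ} M)(x, y) = Σ_c M((x,c),(y,c))`. -/
noncomputable def ptraceOnto {n : ℕ} {d : Fin n → ℕ} (I : Finset (Fin n))
    (M : Matrix (∀ a, Fin (d a)) (∀ a, Fin (d a)) ℂ) :
    Matrix (∀ a : {a : Fin n // a ∈ I}, Fin (d a.1))
      (∀ a : {a : Fin n // a ∈ I}, Fin (d a.1)) ℂ :=
  fun x y => ∑ c : ∀ a : {a : Fin n // a ∉ I}, Fin (d a.1),
    M (mergeIdx I x c) (mergeIdx I y c)

/-- The partial trace as a linear map. -/
noncomputable def ptraceOntoLin {n : ℕ} {d : Fin n → ℕ} (I : Finset (Fin n)) :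
    Matrix (∀ a, Fin (d a)) (∀ a, Fin (d a)) ℂ →ₗ[ℂ]
      Matrix (∀ a : {a : Fin n // a ∈ I}, Fin (d a.1))
        (∀ a : {a : Fin n // a ∈ I}, Fin (d a.1)) ℂ where
  toFun := ptraceOnto I
  map_add' X Y := by
    ext x y
    simp [ptraceOnto, Finset.sum_add_distrib]
  map_smul' c X := by
    ext x y
    simp [ptraceOnto, Finset.mul_sum]

/-- An idempotent matrix of rank `r` factors as `A * B` through dimension `r` with `B * A = 1`. -/
theorem exists_rank_factorization_of_idempotent {K m : Type*} [Field K] [Fintype m]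
    [DecidableEq m] {E : Matrix m m K} (hE : E * E = E) {r : ℕ} (hr : E.rank = r) :
    ∃ (A : Matrix m (Fin r) K) (B : Matrix (Fin r) m K), A * B = E ∧ B * A = 1 := by
  subst hr
  let f : (m → K) →ₗ[K] m → K := E.mulVecLin
  let b : Module.Basis (Fin E.rank) K (LinearMap.range f) := Module.finBasis K _
  let g : (Fin E.rank → K) →ₗ[K] m → K :=
    (LinearMap.range f).subtype ∘ₗ b.equivFun.symm.toLinearMap
  let h : (m → K) →ₗ[K] Fin E.rank → K := b.equivFun.toLinearMap ∘ₗ f.rangeRestrict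
  have hfix (v : LinearMap.range f) : f.rangeRestrict v = v := by
    obtain ⟨_, w, rfl⟩ := v
    ext1
    simp [f, hE]
  have hgh : g ∘ₗ h = f := by
    refine LinearMap.ext fun x => ?_
    simp [g, h]
  have hhg : h ∘ₗ g = LinearMap.id := by
    refine LinearMap.ext fun x => ?_
    simp only [g, h, LinearMap.comp_apply, Submodule.subtype_apply, LinearEquiv.coe_coe, hfix,
      LinearEquiv.apply_symm_apply, LinearMap.id_apply]
  refine ⟨g.toMatrix', h.toMatrix', ?_, ?_⟩
  · rw [← LinearMap.toMatrix'_comp, hgh]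
    exact LinearMap.toMatrix'_toLin' E
  · rw [← LinearMap.toMatrix'_comp, hhg, LinearMap.toMatrix'_id]

/-- Given a solution `ρ` of rank `r` to a local consistency instance `{(ρᵢ, Iᵢ)}`, with `P` the
orthogonal projection onto the range of `ρ` and `Πᵢ` the orthogonal projection onto the range of
`ρᵢ`, the set `M = {X : P X P = X and Πᵢ (tr_{Iᵢᶜ} X) Πᵢ = 0 for all i}` is a complex linear
subspace of the matrices on `H` of dimension at least `r² − Σᵢ (rank ρᵢ)²`. -/
theorem subspace_dim_ge_rank_sq_sub_sum
    (n k : ℕ) (d : Fin n → ℕ) (I : Fin k → Finset (Fin n))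
    (ρloc : ∀ i : Fin k, Matrix (∀ a : {a : Fin n // a ∈ I i}, Fin (d a.1))
      (∀ a : {a : Fin n // a ∈ I i}, Fin (d a.1)) ℂ)
    (hρloc : ∀ i : Fin k, (ρloc i).PosSemidef ∧ (ρloc i).trace = 1)
    (ρ : Matrix (∀ a, Fin (d a)) (∀ a, Fin (d a)) ℂ)
    (hρ : ρ.PosSemidef ∧ ρ.trace = 1)
    (hsol : ∀ i : Fin k, ptraceOnto (I i) ρ = ρloc i)
    (P : Matrix (∀ a, Fin (d a)) (∀ a, Fin (d a)) ℂ)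
    (hP : P.IsHermitian ∧ P * P = P ∧
      LinearMap.range P.mulVecLin = LinearMap.range ρ.mulVecLin)
    (Proj : ∀ i : Fin k, Matrix (∀ a : {a : Fin n // a ∈ I i}, Fin (d a.1))
      (∀ a : {a : Fin n // a ∈ I i}, Fin (d a.1)) ℂ)
    (hProj : ∀ i : Fin k, (Proj i).IsHermitian ∧ Proj i * Proj i = Proj i ∧
      LinearMap.range (Proj i).mulVecLin = LinearMap.range (ρloc i).mulVecLin) :
    ∃ W : Submodule ℂ (Matrix (∀ a, Fin (d a)) (∀ a, Fin (d a)) ℂ),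
      (W : Set (Matrix (∀ a, Fin (d a)) (∀ a, Fin (d a)) ℂ)) =
        {X | P * X * P = X ∧ ∀ i : Fin k, Proj i * ptraceOnto (I i) X * Proj i = 0} ∧
      ρ.rank ^ 2 - ∑ i : Fin k, (ρloc i).rank ^ 2 ≤ Module.finrank ℂ W := by
  classical
  have hrP : P.rank = ρ.rank := by rw [Matrix.rank, Matrix.rank, hP.2.2]
  have hrProj (i : Fin k) : (Proj i).rank = (ρloc i).rank := by
    rw [Matrix.rank, Matrix.rank, (hProj i).2.2]
  obtain ⟨A, B, hAB, hBA⟩ := exists_rank_factorization_of_idempotent hP.2.1 hrP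
  choose C D hCD _ using fun i =>
    exists_rank_factorization_of_idempotent (hProj i).2.1 (hrProj i)
  let W : Submodule ℂ (Matrix (∀ a, Fin (d a)) (∀ a, Fin (d a)) ℂ) :=
    { carrier := {X | P * X * P = X ∧ ∀ i : Fin k, Proj i * ptraceOnto (I i) X * Proj i = 0}
      zero_mem' := by
        refine ⟨by simp, fun i => ?_⟩
        change Proj i * ptraceOntoLin (I i) 0 * Proj i = 0
        simp
      add_mem' := by
        rintro X Y ⟨hX, hX'⟩ ⟨hY, hY'⟩
        refine ⟨by rw [mul_add, add_mul, hX, hY], fun i => ?_⟩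
        change Proj i * ptraceOntoLin (I i) (X + Y) * Proj i = 0
        rw [map_add, mul_add, add_mul]
        exact (congrArg₂ (· + ·) (hX' i) (hY' i)).trans (add_zero 0)
      smul_mem' := by
        rintro c X ⟨hX, hX'⟩
        refine ⟨by rw [Matrix.mul_smul, Matrix.smul_mul, hX], fun i => ?_⟩
        change Proj i * ptraceOntoLin (I i) (c • X) * Proj i = 0
        rw [map_smul, Matrix.mul_smul, Matrix.smul_mul]
        exact (congrArg (c • ·) (hX' i)).trans (smul_zero c) }
  refine ⟨W, rfl, ?_⟩
  let lift : Matrix (Fin ρ.rank) (Fin ρ.rank) ℂ →ₗ[ℂ]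
      Matrix (∀ a, Fin (d a)) (∀ a, Fin (d a)) ℂ :=
    { toFun := fun Y => A * Y * B
      map_add' := fun X Y => by rw [Matrix.mul_add, Matrix.add_mul]
      map_smul' := fun c X => by simp }
  have hlift : Function.Injective lift := by
    refine Function.LeftInverse.injective (g := fun X => B * X * A) fun Y => ?_
    calc B * (A * Y * B) * A = (B * A) * Y * (B * A) := by simp only [Matrix.mul_assoc]
      _ = Y := by rw [hBA, Matrix.one_mul, Matrix.mul_one]
  let compress : Matrix (Fin ρ.rank) (Fin ρ.rank) ℂ →ₗ[ℂ]
      ∀ i : Fin k, Matrix (Fin (ρloc i).rank) (Fin (ρloc i).rank) ℂ :=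
    LinearMap.pi fun i =>
      { toFun := fun Y => D i * ptraceOntoLin (I i) (lift Y) * C i
        map_add' := fun X Y => by rw [map_add, map_add, Matrix.mul_add, Matrix.add_mul]
        map_smul' := fun c X => by simp }
  have hmem : (LinearMap.ker compress).map lift ≤ W := by
    rintro _ ⟨Y, hY, rfl⟩
    refine ⟨?_, fun i => ?_⟩
    · calc P * (A * Y * B) * P = A * (B * A) * Y * (B * A) * B := by
            rw [← hAB]
            simp only [Matrix.mul_assoc]
        _ = A * Y * B := by rw [hBA, Matrix.mul_one, Matrix.mul_one]
    · have hYi : D i * ptraceOnto (I i) (lift Y) * C i = 0 := congrFun hY i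
      calc Proj i * ptraceOnto (I i) (lift Y) * Proj i
          = C i * (D i * ptraceOnto (I i) (lift Y) * C i) * D i := by
            rw [← hCD i]
            simp only [Matrix.mul_assoc]
        _ = 0 := by rw [hYi, Matrix.mul_zero, Matrix.zero_mul]
  have hker : Module.finrank ℂ (LinearMap.ker compress) ≤ Module.finrank ℂ W := by
    rw [(Submodule.equivMapOfInjective lift hlift _).finrank_eq]
    exact Submodule.finrank_mono hmem
  have hrange := Submodule.finrank_le (LinearMap.range compress)
  have hsum := compress.finrank_range_add_finrank_ker
  simp only [Module.finrank_pi_fintype, Module.finrank_matrix, Module.finrank_self,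
    Fintype.card_fin, mul_one, ← sq] at hrange hsum
  omega
end

section
/- Let ρ be a positive semidefinite complex m×m matrix and let H be a Hermitian complex m×m matrix. Then there exists ε > 0 such that both ρ + εH and ρ − εH are positive semidefinite if and only if the range (column space) of H is contained in the range of ρ. -/
open Matrix ComplexOrder

namespace Matrix

theorem range_mulVecLin_le_iff_exists_eq_mul {R l m n : Type*} [CommRing R] [Fintype m]
    [Fintype n] [DecidableEq n] {A : Matrix l n R} {B : Matrix l m R} :
    LinearMap.range A.mulVecLin ≤ LinearMap.range B.mulVecLin ↔ ∃ K : Matrix m n R, A = B * K := by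
  constructor
  · intro h
    have hcol (j : n) : ∃ k : m → R, B *ᵥ k = A.col j := by
      simpa using h ⟨Pi.single j 1, rfl⟩
    choose k hk using hcol
    refine ⟨of fun i j => k j i, ?_⟩
    ext i j
    exact (congrFun (hk j) i).symm
  · rintro ⟨K, rfl⟩
    rw [mulVecLin_mul]
    exact LinearMap.range_comp_le_range _ _

theorem exists_eq_mul_of_ker_mulVecLin_le {F l m n : Type*} [Field F] [Fintype l]
    [Fintype n] {A : Matrix l n F} {B : Matrix m n F}
    (h : LinearMap.ker A.mulVecLin ≤ LinearMap.ker B.mulVecLin) :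
    ∃ N : Matrix m l F, B = N * A := by
  classical
  obtain ⟨s, hs⟩ := A.mulVecLin.rangeRestrict.exists_rightInverse_of_surjective
    A.mulVecLin.range_rangeRestrict
  obtain ⟨g, hg⟩ := (B.mulVecLin ∘ₗ s).exists_extend
  refine ⟨LinearMap.toMatrix' g, ext_of_mulVec_single fun j => ?_⟩
  set x : n → F := Pi.single j 1
  set y := A.mulVecLin.rangeRestrict x
  have hAs : A *ᵥ s y = A *ᵥ x := congrArg Subtype.val (LinearMap.congr_fun hs y)
  have hgy : g (A *ᵥ x) = B *ᵥ s y := LinearMap.congr_fun hg y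
  have hBs : s y - x ∈ LinearMap.ker B.mulVecLin :=
    h (by simp [mulVec_sub, hAs])
  have hBs' : B *ᵥ s y = B *ᵥ x := by
    simpa [mulVec_sub, sub_eq_zero] using hBs
  rw [← mulVec_mulVec, LinearMap.toMatrix'_mulVec, hgy, hBs']

open scoped MatrixOrder Matrix.Norms.L2Operator in
theorem IsHermitian.exists_pos_posSemidef_one_add_smul {n : Type*} [Fintype n] [DecidableEq n]
    {N : Matrix n n ℂ} (hN : N.IsHermitian) :
    ∃ ε : ℝ, 0 < ε ∧ (1 + (ε : ℂ) • N).PosSemidef ∧ (1 - (ε : ℂ) • N).PosSemidef := by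
  have hpos : 0 < ‖N‖ + 1 := by positivity
  have key {M : Matrix n n ℂ} (hM : M ≤ algebraMap ℝ _ ‖N‖) :
      (1 - (((‖N‖ + 1)⁻¹ : ℝ) : ℂ) • M).PosSemidef := by
    have h1 : M ≤ algebraMap ℝ (Matrix n n ℂ) (‖N‖ + 1) :=
      hM.trans (algebraMap_mono _ (by linarith))
    have h2 := (le_iff.mp h1).smul (inv_nonneg.mpr hpos.le)
    rwa [smul_sub, Algebra.algebraMap_eq_smul_one, smul_smul, inv_mul_cancel₀ hpos.ne',
      one_smul] at h2
  have hself : IsSelfAdjoint N := hN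
  refine ⟨(‖N‖ + 1)⁻¹, inv_pos.mpr hpos, ?_, key hself.le_algebraMap_norm_self⟩
  simpa using key (neg_le.mp hself.neg_algebraMap_norm_le_self)

theorem PosSemidef.ker_mulVecLin_le_of_add_sub {n : Type*} [Fintype n] {A B : Matrix n n ℂ}
    (hadd : (A + B).PosSemidef) (hsub : (A - B).PosSemidef) :
    LinearMap.ker A.mulVecLin ≤ LinearMap.ker B.mulVecLin := by
  intro x hx
  have hx : A *ᵥ x = 0 := hx
  have h1 := hadd.dotProduct_mulVec_nonneg x
  have h2 := hsub.dotProduct_mulVec_nonneg x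
  simp only [add_mulVec, sub_mulVec, hx, zero_add, zero_sub, dotProduct_neg] at h1 h2
  have h0 : star x ⬝ᵥ (A + B) *ᵥ x = 0 := by
    rw [add_mulVec, hx, zero_add]
    exact le_antisymm (neg_nonneg.mp h2) h1
  have h3 := (hadd.dotProduct_mulVec_zero_iff x).mp h0
  rwa [add_mulVec, hx, zero_add] at h3

theorem IsHermitian.exists_eq_conjTranspose_mul_mul {n : Type*} [Fintype n] [DecidableEq n]
    {B H : Matrix n n ℂ} (hH : H.IsHermitian)
    (h : LinearMap.range H.mulVecLin ≤ LinearMap.range (Bᴴ * B).mulVecLin) :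
    ∃ N : Matrix n n ℂ, N.IsHermitian ∧ H = Bᴴ * N * B := by
  obtain ⟨K, hK⟩ := range_mulVecLin_le_iff_exists_eq_mul.mp h
  have hK' : H = (B * K)ᴴ * B := by
    rw [← hH.eq, hK]
    simp [Matrix.mul_assoc]
  have hker : LinearMap.ker B.mulVecLin ≤ LinearMap.ker (B * K).mulVecLin := by
    intro x hx
    have hx : B *ᵥ x = 0 := hx
    have hHx : H *ᵥ x = 0 := by rw [hK', ← mulVec_mulVec, hx, mulVec_zero]
    rw [hK, ← mulVec_mulVec, conjTranspose_mul_self_mulVec_eq_zero, mulVec_mulVec] at hHx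
    exact hHx
  obtain ⟨N, hN⟩ := exists_eq_mul_of_ker_mulVecLin_le hker
  have h1 : H = Bᴴ * N * B := by rw [hK, Matrix.mul_assoc, hN, Matrix.mul_assoc]
  have h2 : H = Bᴴ * Nᴴ * B := by
    conv_lhs => rw [hK', hN, conjTranspose_mul]
  refine ⟨(2⁻¹ : ℝ) • (N + Nᴴ), ?_, ?_⟩
  · simp [IsHermitian, add_comm]
  · rw [Matrix.mul_smul, Matrix.smul_mul, Matrix.mul_add, Matrix.add_mul, ← h1, ← h2, ← two_smul ℝ H,
      smul_smul]
    norm_num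

end Matrix

/-- Let `ρ` be a positive semidefinite complex `m × m` matrix and `H` a Hermitian `m × m`
matrix. Then there is `ε > 0` with both `ρ + ε H` and `ρ - ε H` positive semidefinite if and
only if the range (column space) of `H` is contained in the range of `ρ`. -/
theorem exists_pos_eps_posSemidef_iff_range_le
    (m : ℕ) (ρ H : Matrix (Fin m) (Fin m) ℂ)
    (hρ : ρ.PosSemidef) (hH : H.IsHermitian) :
    (∃ ε : ℝ, 0 < ε ∧ (ρ + (ε : ℂ) • H).PosSemidef ∧ (ρ - (ε : ℂ) • H).PosSemidef) ↔
      LinearMap.range H.mulVecLin ≤ LinearMap.range ρ.mulVecLin := by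
  constructor
  · rintro ⟨ε, hε, hadd, hsub⟩
    obtain ⟨N, hN⟩ := exists_eq_mul_of_ker_mulVecLin_le
      (PosSemidef.ker_mulVecLin_le_of_add_sub hadd hsub)
    refine range_mulVecLin_le_iff_exists_eq_mul.mpr ⟨(ε : ℂ)⁻¹ • Nᴴ, ?_⟩
    have hadj : (ε : ℂ) • H = ρ * Nᴴ := by
      simpa [hH.eq, hρ.isHermitian.eq] using congrArg conjTranspose hN
    rw [Matrix.mul_smul, ← hadj, inv_smul_smul₀ (mod_cast hε.ne')]
  · intro h
    obtain ⟨B, rfl⟩ : ∃ B, ρ = Bᴴ * B := by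
      open scoped MatrixOrder in
      exact CStarAlgebra.nonneg_iff_eq_star_mul_self.mp hρ.nonneg
    obtain ⟨N, hN, rfl⟩ := hH.exists_eq_conjTranspose_mul_mul h
    obtain ⟨ε, hε, hadd, hsub⟩ := hN.exists_pos_posSemidef_one_add_smul
    refine ⟨ε, hε, ?_, ?_⟩
    · simpa [Matrix.mul_add, Matrix.add_mul] using hadd.conjTranspose_mul_mul_same B
    · simpa [Matrix.mul_sub, Matrix.sub_mul] using hsub.conjTranspose_mul_mul_same B
end

section
/- Let ρ be a positive semidefinite complex m×m matrix and let H be a nonzero Hermitian complex m×m matrix with trace H = 0 and with the range of H contained in the range of ρ. Then there exists λ with 0 < λ < ∞ such that ρ − λH is positive semidefinite and rank(ρ − λH) < rank(ρ). -/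
open Matrix ComplexOrder

namespace Matrix

variable {n : Type*} [Fintype n]

/-- A positive semidefinite matrix has a Hermitian square root `R` which commutes with a Hermitian
Moore-Penrose inverse `Q` of it. -/
lemma PosSemidef.exists_sqrt_pseudoinverse [DecidableEq n] {A : Matrix n n ℂ} (hA : A.PosSemidef) :
    ∃ R Q : Matrix n n ℂ, R.IsHermitian ∧ Q.IsHermitian ∧ R * R = A ∧ R * Q = Q * R ∧
      R * Q * R = R ∧ Q * R * Q = Q := by
  set φ := Unitary.conjStarAlgAut ℂ _ hA.1.eigenvectorUnitary
  set s : n → ℝ := fun i => √(hA.1.eigenvalues i) with hs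
  have hherm (d : n → ℝ) : (φ (diagonal fun i => (d i : ℂ))).IsHermitian := by
    rw [IsHermitian, ← star_eq_conjTranspose, ← map_star, star_eq_conjTranspose,
      diagonal_conjTranspose]
    congr 2
    ext i
    simp
  refine ⟨φ (diagonal fun i => (s i : ℂ)), φ (diagonal fun i => ((s i)⁻¹ : ℝ)),
    hherm _, hherm _, ?_, ?_, ?_, ?_⟩
  · rw [← map_mul, diagonal_mul_diagonal]
    conv_rhs => rw [hA.1.spectral_theorem]
    congr 2
    ext i
    simp [hs, ← Complex.ofReal_mul, Real.mul_self_sqrt (hA.eigenvalues_nonneg i)]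
  · simp only [← map_mul, diagonal_mul_diagonal, mul_comm]
  · simp only [← map_mul, diagonal_mul_diagonal, ← Complex.ofReal_mul]
    congr 2
    ext i
    by_cases h : s i = 0 <;> simp [h]
  · simp only [← map_mul, diagonal_mul_diagonal, ← Complex.ofReal_mul]
    congr 2
    ext i
    by_cases h : s i = 0 <;> simp [h]

/-- The range of `B` lies in the range of `A` only if `A` divides `B` on the left. -/
lemma exists_eq_mul_of_range_mulVecLin_le [DecidableEq n] {A B : Matrix n n ℂ}
    (h : LinearMap.range B.mulVecLin ≤ LinearMap.range A.mulVecLin) : ∃ X, B = A * X := by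
  have hcol (j : n) : ∃ v, A *ᵥ v = B.col j := by
    obtain ⟨v, hv⟩ := h ⟨Pi.single j 1, rfl⟩
    exact ⟨v, by simpa using hv⟩
  choose v hv using hcol
  refine ⟨(of v)ᵀ, ?_⟩
  ext i j
  exact (congrFun (hv j) i).symm

/-- A Hermitian matrix whose eigenvalues are at most `μ` is at most `μ • 1`. -/
lemma IsHermitian.posSemidef_smul_one_sub [DecidableEq n] {K : Matrix n n ℂ}
    (hK : K.IsHermitian) {μ : ℝ}
    (hμ : ∀ i, hK.eigenvalues i ≤ μ) : ((μ : ℂ) • (1 : Matrix n n ℂ) - K).PosSemidef := by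
  have h : (μ : ℂ) • (1 : Matrix n n ℂ) - K =
      Unitary.conjStarAlgAut ℂ _ hK.eigenvectorUnitary
        (diagonal fun i => ((μ - hK.eigenvalues i : ℝ) : ℂ)) := by
    conv_lhs => rw [hK.spectral_theorem,
      ← map_one (Unitary.conjStarAlgAut ℂ _ hK.eigenvectorUnitary), ← map_smul, ← map_sub]
    congr 1
    ext i j
    by_cases hij : i = j <;> simp [hij]
  rw [h, Unitary.conjStarAlgAut_apply]
  refine PosSemidef.mul_mul_conjTranspose_same (PosSemidef.diagonal fun i => ?_) _
  exact Complex.zero_le_real.2 (sub_nonneg.2 (hμ i))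

/-- If the kernel of `B` strictly contains that of `A`, then `B` has smaller rank. -/
lemma rank_lt_rank_of_mulVec_eq_zero {A B : Matrix n n ℂ} (h : ∀ v, A *ᵥ v = 0 → B *ᵥ v = 0)
    {w : n → ℂ} (hB : B *ᵥ w = 0) (hA : A *ᵥ w ≠ 0) : B.rank < A.rank := by
  have hlt : LinearMap.ker A.mulVecLin < LinearMap.ker B.mulVecLin :=
    SetLike.lt_iff_le_and_exists.2 ⟨fun v hv => h v hv, w, hB, hA⟩
  have := Submodule.finrank_lt_finrank_of_lt hlt
  have h1 := A.mulVecLin.finrank_range_add_finrank_ker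
  have h2 := B.mulVecLin.finrank_range_add_finrank_ker
  rw [rank, rank]
  omega

end Matrix

/-- Let `ρ` be a positive semidefinite complex `m × m` matrix and `H` a nonzero Hermitian
`m × m` matrix with `trace H = 0` whose range is contained in the range of `ρ`. Then there is
`0 < λ < ∞` such that `ρ - λ H` is positive semidefinite and `rank (ρ - λ H) < rank ρ`. -/
theorem exists_pos_smul_sub_posSemidef_rank_lt
    (m : ℕ) (ρ H : Matrix (Fin m) (Fin m) ℂ)
    (hρ : ρ.PosSemidef) (hH : H.IsHermitian) (hH0 : H ≠ 0) (htr : H.trace = 0)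
    (hrange : LinearMap.range H.mulVecLin ≤ LinearMap.range ρ.mulVecLin) :
    ∃ l : ℝ, 0 < l ∧ (ρ - (l : ℂ) • H).PosSemidef ∧ (ρ - (l : ℂ) • H).rank < ρ.rank := by
  obtain ⟨R, Q, hR, hQ, hRR, hRQ, hRQR, hQRQ⟩ := hρ.exists_sqrt_pseudoinverse
  obtain ⟨X, hX⟩ := exists_eq_mul_of_range_mulVecLin_le hrange
  have hPH : R * Q * H = H := by
    rw [hX, ← hRR, ← mul_assoc, ← mul_assoc, hRQR]
  have hX' : H = Xᴴ * ρ := by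
    conv_lhs => rw [← hH.eq, hX, conjTranspose_mul, hρ.1.eq]
  have hHP : H * (Q * R) = H := by
    rw [hX', ← hRR, mul_assoc, mul_assoc, ← mul_assoc R Q R, hRQR]
  set K := Q * H * Q with hKdef
  have hK : K.IsHermitian := by
    simp [IsHermitian, hKdef, conjTranspose_mul, hQ.eq, hH.eq, mul_assoc]
  have hRKR : R * K * R = H := by
    calc R * K * R = R * Q * H * (Q * R) := by simp only [hKdef, mul_assoc]
      _ = H := by rw [hPH, hHP]
  have hQRK : Q * R * K = K := by
    simp only [hKdef, ← mul_assoc, hQRQ]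
  have hpos : ∃ i, 0 < hK.eigenvalues i := by
    by_contra! hle
    have h1 := (hK.posSemidef_smul_one_sub hle).mul_mul_conjTranspose_same R
    have h2 : (-H).PosSemidef := by
      simpa [hR.eq, hRKR] using h1
    exact hH0 (neg_eq_zero.1 (h2.trace_eq_zero_iff.1 (by simp [htr])))
  obtain ⟨j, hj⟩ := hpos
  have : Nonempty (Fin m) := ⟨j⟩
  obtain ⟨i, hi⟩ := Finite.exists_max hK.eigenvalues
  set μ := hK.eigenvalues i
  have hμ0 : 0 < μ := hj.trans_le (hi j)
  have hμC : (μ : ℂ) ≠ 0 := Complex.ofReal_ne_zero.2 hμ0.ne'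
  have hfac : ρ - ((μ⁻¹ : ℝ) : ℂ) • H =
      ((μ⁻¹ : ℝ) : ℂ) • (R * ((μ : ℂ) • (1 : Matrix (Fin m) (Fin m) ℂ) - K) * R) := by
    rw [mul_sub, sub_mul, hRKR, smul_sub]
    rw [Complex.ofReal_inv, mul_smul_comm, mul_one, smul_mul_assoc, hRR, inv_smul_smul₀ hμC]
  obtain ⟨v, hv0, hv⟩ : ∃ v : Fin m → ℂ, v ≠ 0 ∧ K *ᵥ v = (μ : ℂ) • v := by
    refine ⟨hK.eigenvectorBasis i, fun h => ?_, ?_⟩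
    · exact hK.eigenvectorBasis.toBasis.ne_zero i (by ext k; simpa using congrFun h k)
    · simpa using hK.mulVec_eigenvectorBasis i
  have hQRv : (Q * R) *ᵥ v = v := by
    have h : (μ : ℂ) • ((Q * R) *ᵥ v) = (μ : ℂ) • v := by
      rw [← mulVec_smul, ← hv, mulVec_mulVec, hQRK]
    exact smul_right_injective _ hμC h
  refine ⟨μ⁻¹, inv_pos.2 hμ0, ?_, rank_lt_rank_of_mulVec_eq_zero (w := Q *ᵥ v) ?_ ?_ ?_⟩
  · rw [hfac]
    refine PosSemidef.smul ?_ (Complex.zero_le_real.2 (inv_pos.2 hμ0).le)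
    simpa [hR.eq] using (hK.posSemidef_smul_one_sub hi).mul_mul_conjTranspose_same R
  · intro u hu
    rw [sub_mulVec, smul_mulVec, hX', ← mulVec_mulVec, hu]
    simp
  · rw [hfac, smul_mulVec, mulVec_mulVec, mul_assoc, hRQ, ← mulVec_mulVec, hQRv,
      ← mulVec_mulVec, sub_mulVec, hv]
    simp [smul_mulVec]
  · intro h
    apply hv0
    rw [← hRR, mulVec_mulVec, mul_assoc, hRQ, ← mulVec_mulVec, hQRv] at h
    rw [← hQRv, ← mulVec_mulVec, h, mulVec_zero]
end

section
/- Let N, d, k be positive integers with k ≤ N ≤ d. Let σ be a density operator on (ℂ^d)^{⊗N} (a matrix indexed by functions Fin N → Fin d) such that every vector in the range of σ is antisymmetric, and let ρ = tr_{k+1,…,N}(σ) be its partial trace over the last N − k tensor factors (so every vector in the range of ρ is antisymmetric as a k-fold tensor). Then there exists a density operator σ′ on (ℂ^d)^{⊗N}, with every vector in its range antisymmetric, such that tr_{k+1,…,N}(σ′) = ρ and rank σ′ ≤ rank ρ; moreover rank ρ ≤ C(d, k) (the binomial coefficient d choose k). -/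
open Matrix ComplexOrder

/-- Identify `Fin N → Fin d` with `(Fin k → Fin d) × (Fin (N-k) → Fin d)`: combine an index
on the first `k` tensor factors with an index on the last `N - k` factors. -/
def appendIdx {N k d : ℕ} (x : Fin k → Fin d) (c : Fin (N - k) → Fin d) : Fin N → Fin d :=
  fun a => if h : (a : ℕ) < k then x ⟨a, h⟩
    else c ⟨(a : ℕ) - k, by have := a.isLt; omega⟩

/-- Partial trace over the last `N - k` tensor factors of a matrix on `(ℂ^d)^{⊗N}`:
`(tr_{k+1,…,N} M)(x, y) = Σ_c M((x,c),(y,c))`. -/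
noncomputable def ptrLast (N k d : ℕ) (M : Matrix (Fin N → Fin d) (Fin N → Fin d) ℂ) :
    Matrix (Fin k → Fin d) (Fin k → Fin d) ℂ :=
  fun x y => ∑ c : Fin (N - k) → Fin d, M (appendIdx x c) (appendIdx y c)

/-- A vector `v : (Fin N → Fin d) → ℂ` is antisymmetric if
`v (f ∘ π) = sign(π) · v f` for every permutation `π` of `Fin N`. -/
def IsAntisymVec (N d : ℕ) (v : (Fin N → Fin d) → ℂ) : Prop :=
  ∀ (π : Equiv.Perm (Fin N)) (f : Fin N → Fin d),
    v (f ∘ π) = ((Equiv.Perm.sign π : ℤ) : ℂ) * v f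

namespace Matrix

variable {m n : Type*} [Fintype n]

/-- A matrix factors through a space whose dimension is its rank. -/
theorem exists_rank_factorization (A : Matrix m n ℂ) :
    ∃ (B : Matrix m (Fin A.rank) ℂ) (Y : Matrix (Fin A.rank) n ℂ), A = B * Y := by
  classical
  let b : Module.Basis (Fin A.rank) ℂ (LinearMap.range A.mulVecLin) := Module.finBasis ℂ _
  have hmem (j : n) : A.col j ∈ LinearMap.range A.mulVecLin :=
    ⟨Pi.single j 1, by simp⟩
  refine ⟨of fun i s => (b s : m → ℂ) i, of fun s j => b.repr ⟨A.col j, hmem j⟩ s, ?_⟩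
  ext i j
  have h := congrArg (fun v : LinearMap.range A.mulVecLin => (v : m → ℂ) i) (b.sum_repr ⟨A.col j, hmem j⟩)
  simp only [Submodule.coe_sum, Submodule.coe_smul, Finset.sum_apply, Pi.smul_apply, col_apply,
    smul_eq_mul] at h
  simp [mul_apply, ← h, mul_comm]

/-- For a nonzero Hermitian matrix `H` there is a real `t` such that `1 + t H` is positive
semidefinite and singular. -/
theorem IsHermitian.exists_one_add_smul_eq_mul_conjTranspose {r : ℕ}
    {H : Matrix (Fin (r + 1)) (Fin (r + 1)) ℂ} (hH : H.IsHermitian) (hne : H ≠ 0) :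
    ∃ (t : ℝ) (C : Matrix (Fin (r + 1)) (Fin r) ℂ), 1 + (t : ℂ) • H = C * Cᴴ := by
  obtain ⟨j₀, hj₀⟩ := Finite.exists_max fun j => |hH.eigenvalues j|
  have hpos : hH.eigenvalues j₀ ≠ 0 := by
    intro h0
    refine hne (hH.eigenvalues_eq_zero_iff.mp (funext fun j => ?_))
    simpa [h0] using hj₀ j
  let U : Matrix (Fin (r + 1)) (Fin (r + 1)) ℂ := hH.eigenvectorUnitary
  let lam : Fin (r + 1) → ℝ := fun j => 1 + -(hH.eigenvalues j₀)⁻¹ * hH.eigenvalues j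
  have hlam (j : Fin (r + 1)) : 0 ≤ lam j := by
    have h1 : (hH.eigenvalues j₀)⁻¹ * hH.eigenvalues j ≤ 1 := by
      refine (le_abs_self _).trans ?_
      rw [abs_mul, abs_inv, inv_mul_le_iff₀ (abs_pos.mpr hpos), mul_one]
      exact hj₀ j
    simp only [lam]
    linarith
  have hlam₀ : lam j₀ = 0 := by simp [lam, hpos]
  refine ⟨-(hH.eigenvalues j₀)⁻¹,
    of fun i j => U i (j₀.succAbove j) * (√(lam (j₀.succAbove j)) : ℂ), ?_⟩
  have hU : U * star U = 1 := by simp [U]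
  have hspec : H = U * diagonal (fun j => (hH.eigenvalues j : ℂ)) * star U := by
    conv_lhs => rw [hH.spectral_theorem, Unitary.conjStarAlgAut_apply]
    rfl
  have hdiag : (1 : Matrix (Fin (r + 1)) (Fin (r + 1)) ℂ) +
      ((-(hH.eigenvalues j₀)⁻¹ : ℝ) : ℂ) • H = U * diagonal (fun j => (lam j : ℂ)) * star U := by
    have : diagonal (fun j => (lam j : ℂ)) = (1 : Matrix (Fin (r + 1)) (Fin (r + 1)) ℂ) +
        ((-(hH.eigenvalues j₀)⁻¹ : ℝ) : ℂ) • diagonal (fun j => (hH.eigenvalues j : ℂ)) := by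
      ext i j
      by_cases h : i = j <;> simp [lam, h]
    rw [this, Matrix.mul_add, Matrix.add_mul, Matrix.mul_one, hU, Matrix.mul_smul, Matrix.smul_mul,
      ← hspec]
  rw [hdiag]
  ext i l
  rw [mul_apply, mul_apply, Fin.sum_univ_succAbove _ j₀]
  simp only [mul_diagonal, hlam₀, Complex.ofReal_zero, mul_zero, zero_mul, zero_add,
    of_apply, conjTranspose_apply, star_apply, star_mul']
  refine Finset.sum_congr rfl fun j _ => ?_
  have hs : ((√(lam (j₀.succAbove j)) : ℂ)) * (√(lam (j₀.succAbove j)) : ℂ) =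
      (lam (j₀.succAbove j) : ℂ) := by
    rw [← Complex.ofReal_mul, Real.mul_self_sqrt (hlam _)]
  simp only [RCLike.star_def, Complex.conj_ofReal, ← hs]
  ring

/-- If the output of a completely positive map at the identity has rank smaller than the size of
the input, then the same output arises from a singular positive semidefinite input. -/
theorem exists_kraus_sum_eq_of_rank_le {ι : Type*} [Fintype ι] {r : ℕ}
    (A : ι → Matrix n (Fin (r + 1)) ℂ) (hr : (∑ c, A c * (A c)ᴴ).rank ≤ r) :
    ∃ C : Matrix (Fin (r + 1)) (Fin r) ℂ,
      ∑ c, A c * C * (A c * C)ᴴ = ∑ c, A c * (A c)ᴴ := by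
  let D : Matrix n (ι × Fin (r + 1)) ℂ := of fun i p => A p.1 i p.2
  have hD : D * Dᴴ = ∑ c, A c * (A c)ᴴ := by
    ext i j
    simp [D, mul_apply, sum_apply, Fintype.sum_prod_type]
  rw [← hD, rank_self_mul_conjTranspose] at hr
  obtain ⟨B, Y, hBY⟩ := D.exists_rank_factorization
  let Z (c : ι) : Matrix (Fin D.rank) (Fin (r + 1)) ℂ := of fun s j => Y s (c, j)
  have hA (c : ι) : A c = B * Z c := by
    ext i j
    exact congrFun (congrFun hBY i) (c, j)
  let Φ : Matrix (Fin (r + 1)) (Fin (r + 1)) ℂ →ₗ[ℂ] Matrix (Fin D.rank) (Fin D.rank) ℂ :=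
    { toFun := fun H => ∑ c, Z c * H * (Z c)ᴴ
      map_add' := fun H K => by
        simp [Matrix.mul_add, Matrix.add_mul, Finset.sum_add_distrib]
      map_smul' := fun a H => by simp [Finset.smul_sum] }
  have hΦ (H) : Φ H = ∑ c, Z c * H * (Z c)ᴴ := rfl
  have hker : LinearMap.ker Φ ≠ ⊥ := by
    apply Φ.ker_ne_bot_of_finrank_lt
    simp only [Module.finrank_matrix, Fintype.card_fin, Module.finrank_self, mul_one]
    nlinarith
  obtain ⟨K, hK, hK0⟩ := (Submodule.ne_bot_iff _).mp hker
  rw [LinearMap.mem_ker] at hK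
  have hKstar : Φ Kᴴ = 0 := by
    have : Φ Kᴴ = (Φ K)ᴴ := by
      simp [hΦ, conjTranspose_sum, Matrix.mul_assoc]
    rw [this, hK, conjTranspose_zero]
  obtain ⟨H, hH, hH0, hHΦ⟩ : ∃ H, IsHermitian H ∧ H ≠ 0 ∧ Φ H = 0 := by
    by_cases h : K + Kᴴ = 0
    · refine ⟨Complex.I • K, ?_, smul_ne_zero Complex.I_ne_zero hK0, by simp [hK]⟩
      have : Kᴴ = -K := eq_neg_of_add_eq_zero_right h
      simp [IsHermitian, conjTranspose_smul, this]
    · exact ⟨K + Kᴴ, isHermitian_add_transpose_self K, h, by rw [map_add, hK, hKstar, add_zero]⟩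
  obtain ⟨t, C, hC⟩ := hH.exists_one_add_smul_eq_mul_conjTranspose hH0
  have hsum (M : Matrix (Fin (r + 1)) (Fin (r + 1)) ℂ) :
      ∑ c, A c * M * (A c)ᴴ = B * Φ M * Bᴴ := by
    simp only [hΦ, hA, conjTranspose_mul, Matrix.mul_sum, Matrix.sum_mul,
      Matrix.mul_assoc]
  refine ⟨C, ?_⟩
  calc ∑ c, A c * C * (A c * C)ᴴ = ∑ c, A c * (C * Cᴴ) * (A c)ᴴ := by
        simp only [conjTranspose_mul, Matrix.mul_assoc]
    _ = ∑ c, A c * (1 : Matrix (Fin (r + 1)) (Fin (r + 1)) ℂ) * (A c)ᴴ := by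
        rw [← hC, hsum, hsum, map_add, map_smul, hHΦ, smul_zero, add_zero]
    _ = _ := by simp only [Matrix.mul_one]

end Matrix

section Antisymmetric

variable {N d k : ℕ}

/-- The subspace of antisymmetric vectors. -/
def antisymSubmodule (N d : ℕ) : Submodule ℂ ((Fin N → Fin d) → ℂ) where
  carrier := {v | IsAntisymVec N d v}
  add_mem' := fun hv hw π f => by simp [hv π f, hw π f, mul_add]
  zero_mem' := fun π f => by simp
  smul_mem' := fun a v hv π f => by simp only [Pi.smul_apply, smul_eq_mul, hv π f]; ring

theorem range_mulVecLin_le_antisymSubmodule {n : Type*} [Fintype n]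
    {M : Matrix (Fin N → Fin d) n ℂ} (hM : ∀ j, IsAntisymVec N d (M.col j)) :
    LinearMap.range M.mulVecLin ≤ antisymSubmodule N d := by
  rw [Matrix.range_mulVecLin, Submodule.span_le]
  rintro _ ⟨j, rfl⟩
  exact hM j

theorem IsAntisymVec.apply_eq_zero {v : (Fin k → Fin d) → ℂ} (hv : IsAntisymVec k d v)
    {f : Fin k → Fin d} (hf : ¬ Function.Injective f) : v f = 0 := by
  obtain ⟨i, j, hij, hne⟩ := Function.not_injective_iff.mp hf
  have hcomp : f ∘ Equiv.swap i j = f := by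
    funext a
    rcases eq_or_ne a i with rfl | hi
    · simp [hij]
    rcases eq_or_ne a j with rfl | hj
    · simp [hij]
    · simp [Equiv.swap_apply_of_ne_of_ne hi hj]
  have h := hv (Equiv.swap i j) f
  rw [hcomp, Equiv.Perm.sign_swap hne] at h
  have h2 : (2 : ℂ) * v f = 0 := by push_cast at h; linear_combination h
  simpa using h2

/-- An antisymmetric vector vanishing at all strictly monotone indices is zero. -/
theorem IsAntisymVec.eq_zero {v : (Fin k → Fin d) → ℂ} (hv : IsAntisymVec k d v)
    (h0 : ∀ f : Fin k → Fin d, StrictMono f → v f = 0) : v = 0 := by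
  funext f
  by_cases hf : Function.Injective f
  · have h := hv (Tuple.sort f) f
    rw [h0 _ ((Tuple.monotone_sort f).strictMono_of_injective
      (hf.comp (Tuple.sort f).injective))] at h
    have hs : ((Equiv.Perm.sign (Tuple.sort f) : ℤ) : ℂ) ≠ 0 := by simp
    exact (mul_eq_zero.mp h.symm).resolve_left hs
  · exact hv.apply_eq_zero hf

theorem finrank_antisymSubmodule_le (k d : ℕ) :
    Module.finrank ℂ (antisymSubmodule k d) ≤ d.choose k := by
  let T := {s : Finset (Fin d) // s.card = k}
  let ev : antisymSubmodule k d →ₗ[ℂ] (T → ℂ) :=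
    LinearMap.pi fun s => LinearMap.proj (s.1.orderEmbOfFin s.2 : Fin k → Fin d) ∘ₗ
      (antisymSubmodule k d).subtype
  have hinj : Function.Injective ev := by
    rw [← LinearMap.ker_eq_bot, LinearMap.ker_eq_bot']
    intro v hv
    refine Subtype.ext (IsAntisymVec.eq_zero v.2 fun f hf => ?_)
    let s : T := ⟨Finset.univ.image f, by
      rw [Finset.card_image_of_injective _ hf.injective, Finset.card_univ, Fintype.card_fin]⟩
    have hfs : f = s.1.orderEmbOfFin s.2 :=
      Finset.orderEmbOfFin_unique s.2 (fun x => Finset.mem_image_of_mem f (Finset.mem_univ x)) hf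
    rw [hfs]
    exact congrFun hv s
  refine (LinearMap.finrank_le_finrank_of_injective hinj).trans_eq ?_
  rw [Module.finrank_fintype_fun_eq_card]
  simp [T, Fintype.card_finset_len]

/-- Splitting of the indices of an `N`-fold tensor into its first `k` and last `N - k` factors. -/
def appendIdxEquiv (d : ℕ) (hkN : k ≤ N) :
    (Fin k → Fin d) × (Fin (N - k) → Fin d) ≃ (Fin N → Fin d) where
  toFun p := appendIdx p.1 p.2
  invFun f := (fun i => f ⟨i, by omega⟩, fun i => f ⟨i + k, by omega⟩)
  left_inv p := by
    ext i <;> simp [appendIdx]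
  right_inv f := by
    funext a
    by_cases h : (a : ℕ) < k
    · simp [appendIdx, h]
    · simp [appendIdx, h, Nat.sub_add_cancel (not_lt.mp h)]

theorem trace_ptrLast (hkN : k ≤ N) (M : Matrix (Fin N → Fin d) (Fin N → Fin d) ℂ) :
    (ptrLast N k d M).trace = M.trace := by
  simp only [Matrix.trace, Matrix.diag, ptrLast]
  rw [← (appendIdxEquiv d hkN).sum_comp, Fintype.sum_prod_type]
  rfl

theorem exists_perm_appendIdx_comp (hkN : k ≤ N) (π : Equiv.Perm (Fin k)) :
    ∃ π' : Equiv.Perm (Fin N), Equiv.Perm.sign π' = Equiv.Perm.sign π ∧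
      ∀ (x : Fin k → Fin d) (c : Fin (N - k) → Fin d),
        appendIdx (x ∘ π) c = appendIdx x c ∘ π' := by
  let e : Fin k ≃ {a : Fin N // (a : ℕ) < k} :=
    { toFun := fun i => ⟨⟨i, by omega⟩, i.2⟩
      invFun := fun a => ⟨a.1, a.2⟩
      left_inv := fun _ => rfl
      right_inv := fun _ => rfl }
  refine ⟨π.extendDomain e, Equiv.Perm.sign_extendDomain _ _, fun x c => ?_⟩
  funext a
  by_cases h : (a : ℕ) < k
  · simp [appendIdx, h, Equiv.Perm.extendDomain_apply_subtype π e h, e]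
  · simp [appendIdx, h, Equiv.Perm.extendDomain_apply_not_subtype π e h]

theorem isAntisymVec_col_ptrLast (hkN : k ≤ N) {M : Matrix (Fin N → Fin d) (Fin N → Fin d) ℂ}
    (hM : ∀ g, IsAntisymVec N d (M.col g)) (y : Fin k → Fin d) :
    IsAntisymVec k d ((ptrLast N k d M).col y) := by
  intro π f
  obtain ⟨π', hs, hπ'⟩ := exists_perm_appendIdx_comp (d := d) hkN π
  simp only [Matrix.col_apply, ptrLast, hπ', Finset.mul_sum, ← hs]
  exact Finset.sum_congr rfl fun c _ => hM _ π' _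

theorem ptrLast_mul_conjTranspose {n : Type*} [Fintype n] (A : Matrix (Fin N → Fin d) n ℂ) :
    ptrLast N k d (A * Aᴴ) = ∑ c : Fin (N - k) → Fin d,
      A.submatrix (fun x => appendIdx x c) id * (A.submatrix (fun x => appendIdx x c) id)ᴴ := by
  ext x y
  simp [ptrLast, Matrix.sum_apply, Matrix.mul_apply]

/-- Every column of a factor `A` of `A * Aᴴ` inherits the antisymmetry of the range. -/
theorem isAntisymVec_col_of_mul_conjTranspose {n : Type*} [Fintype n]
    {A : Matrix (Fin N → Fin d) n ℂ}
    (h : ∀ g, IsAntisymVec N d ((A * Aᴴ).col g)) (j : n) : IsAntisymVec N d (A.col j) := by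
  classical
  intro π f
  let u : (Fin N → Fin d) → ℂ :=
    Pi.single (f ∘ π) 1 - ((Equiv.Perm.sign π : ℤ) : ℂ) • Pi.single f 1
  have hu : u ᵥ* (A * Aᴴ) = 0 := by
    funext g
    have := h g π f
    simp only [Matrix.col_apply] at this
    simp [u, Matrix.sub_vecMul, Matrix.smul_vecMul, this]
  have := congrFun ((Matrix.vecMul_self_mul_conjTranspose_eq_zero A u).mp hu) j
  simpa [u, Matrix.sub_vecMul, Matrix.smul_vecMul, sub_eq_zero] using this

theorem isAntisymVec_col_mul {m n : Type*} [Fintype n] {A : Matrix (Fin N → Fin d) n ℂ}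
    (hA : ∀ j, IsAntisymVec N d (A.col j)) (B : Matrix n m ℂ) (j : m) :
    IsAntisymVec N d ((A * B).col j) :=
  range_mulVecLin_le_antisymSubmodule hA ⟨B.col j, rfl⟩

end Antisymmetric

/-- **Rank reduction for the fermionic `N`-representability problem.**
If an `N`-fermion density operator `σ` on `(ℂ^d)^{⊗N}` (every vector in its range is
antisymmetric) has `k`-particle reduced state `ρ = tr_{k+1,…,N}(σ)`, then there is an
`N`-fermion density operator `σ'` with `tr_{k+1,…,N}(σ') = ρ` and
`rank σ' ≤ rank ρ`; moreover `rank ρ ≤ C(d, k)`. -/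
theorem fermionic_rank_reduction
    (N d k : ℕ) (hN : 0 < N) (hd : 0 < d) (hk : 0 < k) (hkN : k ≤ N) (hNd : N ≤ d)
    (σ : Matrix (Fin N → Fin d) (Fin N → Fin d) ℂ)
    (hσ : σ.PosSemidef ∧ σ.trace = 1)
    (hanti : ∀ v ∈ LinearMap.range σ.mulVecLin, IsAntisymVec N d v) :
    ∃ σ' : Matrix (Fin N → Fin d) (Fin N → Fin d) ℂ,
      (σ'.PosSemidef ∧ σ'.trace = 1) ∧
      (∀ v ∈ LinearMap.range σ'.mulVecLin, IsAntisymVec N d v) ∧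
      ptrLast N k d σ' = ptrLast N k d σ ∧
      σ'.rank ≤ (ptrLast N k d σ).rank ∧
      (ptrLast N k d σ).rank ≤ Nat.choose d k := by
  classical
  obtain ⟨m, v, hv⟩ := Matrix.posSemidef_iff_eq_sum_vecMulVec.mp hσ.1
  have hcol (g) : IsAntisymVec N d (σ.col g) :=
    hanti _ ⟨Pi.single g 1, by simp⟩
  have hex : ∃ r, ∃ A : Matrix (Fin N → Fin d) (Fin r) ℂ,
      (∀ j, IsAntisymVec N d (A.col j)) ∧ ptrLast N k d (A * Aᴴ) = ptrLast N k d σ := by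
    let A : Matrix (Fin N → Fin d) (Fin m) ℂ := Matrix.of fun f i => v i f
    have hA : A * Aᴴ = σ := by
      rw [hv]
      ext f g
      simp [A, Matrix.mul_apply, Matrix.sum_apply, Matrix.vecMulVec_apply]
    exact ⟨m, A, isAntisymVec_col_of_mul_conjTranspose (by simpa only [hA] using hcol), by rw [hA]⟩
  have hmin : Nat.find hex ≤ (ptrLast N k d σ).rank := by
    by_contra! hlt
    obtain ⟨r, hr⟩ : ∃ r, Nat.find hex = r + 1 := ⟨Nat.find hex - 1, by omega⟩
    have hnot := Nat.find_min hex (m := r) (by omega)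
    obtain ⟨A, hA, hAρ⟩ := hr ▸ Nat.find_spec hex
    rw [hr] at hlt
    rw [← hAρ, ptrLast_mul_conjTranspose] at hlt
    obtain ⟨C, hC⟩ := Matrix.exists_kraus_sum_eq_of_rank_le _ (Nat.lt_succ_iff.mp hlt)
    refine hnot ⟨A * C, isAntisymVec_col_mul hA C, ?_⟩
    rw [← hAρ, ptrLast_mul_conjTranspose, ptrLast_mul_conjTranspose, ← hC]
    rfl
  obtain ⟨A, hA, hAρ⟩ := Nat.find_spec hex
  refine ⟨A * Aᴴ, ⟨Matrix.posSemidef_self_mul_conjTranspose A, ?_⟩, ?_, hAρ, ?_, ?_⟩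
  · rw [← trace_ptrLast hkN, hAρ, trace_ptrLast hkN, hσ.2]
  · exact range_mulVecLin_le_antisymSubmodule (isAntisymVec_col_mul hA _)
  · rw [Matrix.rank_self_mul_conjTranspose]
    exact A.rank_le_card_width.trans (by simpa using hmin)
  · exact (Submodule.finrank_mono (range_mulVecLin_le_antisymSubmodule
      (isAntisymVec_col_ptrLast hkN hcol))).trans (finrank_antisymSubmodule_le k d)
end

section
/- Let n ≥ 5. On the n-qubit space (ℂ²)^{⊗n} (matrices indexed by functions Fin n → Fin 2), for each i ∈ {1,…,n} (indices taken mod n, cyclically) let g_i be the operator acting as the Pauli matrix Z on qubit i−1, as the Pauli matrix X on qubit i, as Z on qubit i+1, and as the identity on all other qubits. Let ρ_n = 2^{−n} Π_{i=1}^n (I + g_i). Then: (a) ρ_n is a rank-one orthogonal projection, i.e. ρ_n² = ρ_n, ρ_n is Hermitian, and trace ρ_n = 1 (so ρ_n = |ψ_n⟩⟨ψ_n| is a pure n-qubit state); and (b) for every pair of distinct qubits j ≠ l, the partial trace of ρ_n over all qubits other than j and l equals I₄/4, the maximally mixed state on two qubits. -/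
open Matrix ComplexOrder

/-- The Pauli `X` matrix. -/
def PauliX : Matrix (Fin 2) (Fin 2) ℂ := !![0, 1; 1, 0]

/-- The Pauli `Z` matrix. -/
def PauliZ : Matrix (Fin 2) (Fin 2) ℂ := !![1, 0; 0, -1]

/-- The stabilizer generator `g i = Z_{i-1} X_i Z_{i+1}` of the ring graph state on `n` qubits:
it acts as `Z` on qubits `i - 1` and `i + 1` (cyclically), as `X` on qubit `i`, and as the
identity on all other qubits. -/
noncomputable def ringGen (n : ℕ) [NeZero n] (i : Fin n) :
    Matrix (Fin n → Fin 2) (Fin n → Fin 2) ℂ :=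
  fun f f' => ∏ a : Fin n,
    (if a = i - 1 then PauliZ else if a = i then PauliX
      else if a = i + 1 then PauliZ else 1) (f a) (f' a)

/-- The ring graph state `ρ_n = 2^{-n} Π_{i=1}^n (I + g_i)`. -/
noncomputable def ringGraphState (n : ℕ) [NeZero n] :
    Matrix (Fin n → Fin 2) (Fin n → Fin 2) ℂ :=
  ((2 : ℂ) ^ n)⁻¹ • (((List.finRange n).map fun i => 1 + ringGen n i).prod)

/-- The sign `(-1)^{pq}` contributed by a controlled-`Z` gate. -/
def czSign (p q : Fin 2) : ℂ := if p = 1 ∧ q = 1 then -1 else 1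

/-- The unnormalised amplitude `∏ₐ (-1)^{f(a) f(a+1)}` of the ring graph state. -/
noncomputable def ringSign (n : ℕ) [NeZero n] (f : Fin n → Fin 2) : ℂ :=
  ∏ a, czSign (f a) (f (a + 1))

/-- Flip the `i`-th bit of a bit string. -/
def flipBit {ι : Type*} [DecidableEq ι] (i : ι) (f : ι → Fin 2) : ι → Fin 2 :=
  Function.update f i (f i + 1)

lemma flipBit_ne {ι : Type*} [DecidableEq ι] (i : ι) (f : ι → Fin 2) : flipBit i f ≠ f := by
  intro h
  have := congrFun h i
  simp [flipBit] at this

lemma flipBit_flipBit {ι : Type*} [DecidableEq ι] (i : ι) (f : ι → Fin 2) :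
    flipBit i (flipBit i f) = f := by
  have h : ∀ p : Fin 2, p + 1 + 1 = p := by decide
  simp [flipBit, h]

lemma ringSign_mul_self (n : ℕ) [NeZero n] (f : Fin n → Fin 2) :
    ringSign n f * ringSign n f = 1 := by
  rw [ringSign, ← Finset.prod_mul_distrib]
  refine Finset.prod_eq_one fun a _ => ?_
  unfold czSign
  split_ifs <;> norm_num

lemma star_ringSign (n : ℕ) [NeZero n] (f : Fin n → Fin 2) :
    star (ringSign n f) = ringSign n f := by
  rw [ringSign, star_prod]
  refine Finset.prod_congr rfl fun a _ => ?_
  unfold czSign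
  split_ifs <;> simp

lemma natCast_fin_ne_zero {n : ℕ} [NeZero n] {m : ℕ} (hm : 0 < m) (h : m < n) :
    Fin.ofNat n m ≠ 0 := by
  intro h0
  have := congrArg Fin.val h0
  simp [Fin.ofNat, Nat.mod_eq_of_lt h] at this
  omega

open Fin.CommRing in
lemma fin_small_ne_zero {n : ℕ} [NeZero n] (hn : 5 ≤ n) :
    (1 : Fin n) ≠ 0 ∧ (1 + 1 : Fin n) ≠ 0 ∧ (1 + 1 + 1 : Fin n) ≠ 0 ∧
      (1 + 1 + 1 + 1 : Fin n) ≠ 0 := by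
  have h (m : ℕ) (hm : 0 < m) (hmn : m < n) : ((m : ℕ) : Fin n) ≠ 0 :=
    natCast_fin_ne_zero hm hmn
  have h1 := h 1 (by omega) (by omega)
  have h2 := h 2 (by omega) (by omega)
  have h3 := h 3 (by omega) (by omega)
  have h4 := h 4 (by omega) (by omega)
  push_cast at h1 h2 h3 h4
  refine ⟨h1, ?_, ?_, ?_⟩
  · intro e; apply h2; rw [← e]; norm_num
  · intro e; apply h3; rw [← e]; norm_num
  · intro e; apply h4; rw [← e]; norm_num

lemma ringSign_mul_ringSign_flipBit {n : ℕ} [NeZero n] (hn : 5 ≤ n) (i : Fin n)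
    (f : Fin n → Fin 2) :
    ringSign n f * ringSign n (flipBit i f) =
      PauliZ (f (i - 1)) (f (i - 1)) * PauliZ (f (i + 1)) (f (i + 1)) := by
  obtain ⟨h1, -, -, -⟩ := fin_small_ne_zero hn
  have hpt (a : Fin n) : czSign (f a) (f (a + 1)) *
      czSign (flipBit i f a) (flipBit i f (a + 1)) =
      (if a = i - 1 then PauliZ (f a) (f a) else 1) *
        (if a = i then PauliZ (f (a + 1)) (f (a + 1)) else 1) := by
    have hcz : ∀ p q : Fin 2, czSign p q * czSign p q = 1 := by
      intro p q; unfold czSign; split_ifs <;> norm_num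
    have hl : ∀ p q : Fin 2, czSign p q * czSign (p + 1) q = PauliZ q q := by
      intro p q; fin_cases p <;> fin_cases q <;> simp [czSign, PauliZ]
    have hr : ∀ p q : Fin 2, czSign p q * czSign p (q + 1) = PauliZ p p := by
      intro p q; fin_cases p <;> fin_cases q <;> simp [czSign, PauliZ]
    rw [if_congr (eq_sub_iff_add_eq (a := a) (b := i) (c := 1)) rfl rfl]
    by_cases ha : a = i
    · subst ha
      simp [flipBit, h1, hl]
    · by_cases hb : a + 1 = i
      · subst hb
        simp [flipBit, h1, hr]
      · simp [flipBit, ha, hb, hcz]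
  rw [ringSign, ringSign, ← Finset.prod_mul_distrib, Finset.prod_congr rfl fun a _ => hpt a,
    Finset.prod_mul_distrib]
  simp

lemma ringGen_apply {n : ℕ} [NeZero n] (hn : 5 ≤ n) (i : Fin n) (f f' : Fin n → Fin 2) :
    ringGen n i f f' = if f' = flipBit i f then ringSign n f * ringSign n f' else 0 := by
  obtain ⟨h1, h2, -, -⟩ := fin_small_ne_zero hn
  have hi : i ≠ i - 1 := by
    intro h
    apply h1
    have := congrArg (· + 1 - i) h
    simpa using this
  have hi' : i - 1 ≠ i + 1 := by
    intro h
    apply h2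
    have := congrArg (· + 1 - i) h
    simp only [sub_add_cancel, sub_self] at this
    rw [this]
    abel
  split_ifs with h
  · subst h
    rw [ringSign_mul_ringSign_flipBit hn, ringGen]
    have hpt (a : Fin n) : (if a = i - 1 then PauliZ else if a = i then PauliX
        else if a = i + 1 then PauliZ else 1) (f a) (flipBit i f a) =
        (if a = i - 1 then PauliZ (f a) (f a) else 1) *
        (if a = i + 1 then PauliZ (f a) (f a) else 1) := by
      have hx : ∀ p : Fin 2, PauliX p (p + 1) = 1 := by
        intro p; fin_cases p <;> simp [PauliX]
      by_cases ha : a = i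
      · subst ha
        simp [hi, h1, flipBit, hx]
      · by_cases hb : a = i - 1
        · subst hb
          simp [flipBit, hi.symm, hi']
        · have hfl : flipBit i f a = f a := by simp [flipBit, ha]
          rw [hfl]
          by_cases hc : a = i + 1
          · subst hc
            simp [h1, hi'.symm]
          · simp [ha, hb, hc]
    rw [Finset.prod_congr rfl fun a _ => hpt a, Finset.prod_mul_distrib]
    simp
  · obtain ⟨a, ha⟩ := Function.ne_iff.mp h
    refine Finset.prod_eq_zero (Finset.mem_univ a) ?_
    have hz : ∀ p q : Fin 2, q ≠ p → PauliZ p q = 0 := by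
      intro p q; fin_cases p <;> fin_cases q <;> simp [PauliZ]
    have hx : ∀ p q : Fin 2, q ≠ p + 1 → PauliX p q = 0 := by
      intro p q; fin_cases p <;> fin_cases q <;> simp [PauliX]
    by_cases hai : a = i
    · subst hai
      simp only [hi, if_false, if_true]
      exact hx _ _ (by simpa [flipBit] using ha)
    · have ha' : f' a ≠ f a := by simpa [flipBit, hai] using ha
      simp only [hai, if_false]
      split_ifs
      · exact hz _ _ ha'
      · exact hz _ _ ha'
      · exact Matrix.one_apply_ne ha'.symm

lemma prod_one_add_ringGen_apply {n : ℕ} [NeZero n] (hn : 5 ≤ n) (L : List (Fin n))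
    (hL : L.Nodup) (f f' : Fin n → Fin 2) :
    (L.map fun i => 1 + ringGen n i).prod f f' =
      if ∀ a, a ∉ L → f a = f' a then ringSign n f * ringSign n f' else 0 := by
  induction L generalizing f with
  | nil =>
    by_cases h : f = f'
    · subst h
      simp [ringSign_mul_self]
    · simp [Matrix.one_apply_ne h, ← funext_iff, h]
  | cons i L ih =>
    obtain ⟨hi, hL'⟩ := List.nodup_cons.mp hL
    have hg (P : Matrix (Fin n → Fin 2) (Fin n → Fin 2) ℂ) :
        (ringGen n i * P) f f' =
          ringSign n f * ringSign n (flipBit i f) * P (flipBit i f) f' := by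
      simp [Matrix.mul_apply, ringGen_apply hn]
    rw [List.map_cons, List.prod_cons, add_mul, one_mul, Matrix.add_apply, hg, ih hL', ih hL']
    have hs : ringSign n f * ringSign n (flipBit i f) *
        (ringSign n (flipBit i f) * ringSign n f') = ringSign n f * ringSign n f' := by
      linear_combination ringSign n f * ringSign n f' * ringSign_mul_self n (flipBit i f)
    have h1 : (∀ a, a ∉ L → f a = f' a) ↔ (∀ a, a ∉ i :: L → f a = f' a) ∧ f i = f' i := by
      simp only [List.mem_cons, not_or]
      refine ⟨fun h => ⟨fun a ha => h a ha.2, h i hi⟩, fun h a ha => ?_⟩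
      by_cases hai : a = i
      · exact hai ▸ h.2
      · exact h.1 a ⟨hai, ha⟩
    have h2 : (∀ a, a ∉ L → flipBit i f a = f' a) ↔
        (∀ a, a ∉ i :: L → f a = f' a) ∧ f i ≠ f' i := by
      have hb : ∀ p q : Fin 2, p + 1 = q ↔ p ≠ q := by decide
      rw [← hb]
      simp only [List.mem_cons, not_or]
      refine ⟨fun h => ⟨fun a ha => ?_, ?_⟩, fun h a ha => ?_⟩
      · simpa [flipBit, ha.1] using h a ha.2
      · simpa [flipBit] using h i hi
      · by_cases hai : a = i
        · subst hai
          simpa [flipBit] using h.2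
        · simpa [flipBit, hai] using h.1 a ⟨hai, ha⟩
    simp only [h1, h2]
    by_cases hA : ∀ a, a ∉ i :: L → f a = f' a <;> by_cases hB : f i = f' i
    · rw [if_pos ⟨hA, hB⟩, if_neg (fun h => h.2 hB), if_pos hA, mul_zero, add_zero]
    · rw [if_neg (fun h => hB h.2), if_pos ⟨hA, hB⟩, if_pos hA, hs, zero_add]
    · rw [if_neg (fun h => hA h.1), if_neg (fun h => hA h.1), if_neg hA, mul_zero, add_zero]
    · rw [if_neg (fun h => hA h.1), if_neg (fun h => hA h.1), if_neg hA, mul_zero, add_zero]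

lemma ringGraphState_apply {n : ℕ} [NeZero n] (hn : 5 ≤ n) (f f' : Fin n → Fin 2) :
    ringGraphState n f f' = ((2 : ℂ) ^ n)⁻¹ * (ringSign n f * ringSign n f') := by
  rw [ringGraphState, Matrix.smul_apply, prod_one_add_ringGen_apply hn _ (List.nodup_finRange n),
    if_pos (by simp), smul_eq_mul]

lemma ringGraphState_mul_self {n : ℕ} [NeZero n] (hn : 5 ≤ n) :
    ringGraphState n * ringGraphState n = ringGraphState n := by
  ext f f'
  have h (g : Fin n → Fin 2) : ringGraphState n f g * ringGraphState n g f' =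
      ((2 : ℂ) ^ n)⁻¹ * ringGraphState n f f' := by
    simp only [ringGraphState_apply hn]
    linear_combination ((2 : ℂ) ^ n)⁻¹ * ((2 : ℂ) ^ n)⁻¹ * ringSign n f * ringSign n f' *
      ringSign_mul_self n g
  simp [Matrix.mul_apply, h]

lemma ringGraphState_isHermitian {n : ℕ} [NeZero n] (hn : 5 ≤ n) :
    (ringGraphState n).IsHermitian := by
  ext f f'
  have h (g : Fin n → Fin 2) : (starRingEnd ℂ) (ringSign n g) = ringSign n g := star_ringSign n g
  simp [ringGraphState_apply hn, h, mul_comm]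

lemma trace_ringGraphState {n : ℕ} [NeZero n] (hn : 5 ≤ n) : (ringGraphState n).trace = 1 := by
  simp [Matrix.trace, ringGraphState_apply hn, ringSign_mul_self]

/-- In a cyclic arrangement of at least five sites, for all `j` and `l`, the site `j` has
a neighbour `k ≠ l` whose other neighbour `p` is neither `j` nor `l`. -/
lemma exists_neighbour_avoiding {R : Type*} [CommRing R] (h1 : (1 : R) ≠ 0)
    (h2 : (1 + 1 : R) ≠ 0) (h3 : (1 + 1 + 1 : R) ≠ 0) (h4 : (1 + 1 + 1 + 1 : R) ≠ 0) (j l : R) :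
    ∃ k p : R, k ≠ j ∧ k ≠ l ∧ p ≠ j ∧ p ≠ l ∧
      ((k - 1 = j ∧ k + 1 = p) ∨ (k - 1 = p ∧ k + 1 = j)) := by
  by_cases hl : l = j + 1
  · subst hl
    exact ⟨j - 1, j - 1 - 1, fun h => h1 (by linear_combination -h),
      fun h => h2 (by linear_combination -h), fun h => h2 (by linear_combination -h),
      fun h => h3 (by linear_combination -h), Or.inr ⟨rfl, by ring⟩⟩
  by_cases hl' : l = j + 1 + 1
  · subst hl'
    exact ⟨j - 1, j - 1 - 1, fun h => h1 (by linear_combination -h),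
      fun h => h3 (by linear_combination -h), fun h => h2 (by linear_combination -h),
      fun h => h4 (by linear_combination -h), Or.inr ⟨rfl, by ring⟩⟩
  exact ⟨j + 1, j + 1 + 1, fun h => h1 (by linear_combination h), Ne.symm hl,
    fun h => h2 (by linear_combination h), Ne.symm hl', Or.inl ⟨by ring, rfl⟩⟩

lemma mergeIdx_flipBit {n : ℕ} (I : Finset (Fin n)) (x : {a : Fin n // a ∈ I} → Fin 2)
    (c : {a : Fin n // a ∉ I} → Fin 2) (k : {a : Fin n // a ∉ I}) :
    mergeIdx (d := fun _ => 2) I x (flipBit k c) =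
      flipBit k.1 (mergeIdx (d := fun _ => 2) I x c) := by
  funext a
  by_cases hk : a = k.1
  · subst hk
    simp [mergeIdx, flipBit, k.2]
  · by_cases ha : a ∈ I <;> simp [mergeIdx, flipBit, ha, hk, Subtype.ext_iff]

open Fin.CommRing in
/-- The partial trace of the ring graph state has no entry between strings differing at `j`. -/
lemma sum_ringSign_mergeIdx_eq_zero {n : ℕ} [NeZero n] (hn : 5 ≤ n) {j l : Fin n}
    {I : Finset (Fin n)} (hI : ∀ a, a ∈ I ↔ a = j ∨ a = l)
    (x y : {a : Fin n // a ∈ I} → Fin 2) (hxy : ∀ h : j ∈ I, x ⟨j, h⟩ ≠ y ⟨j, h⟩) :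
    ∑ c : {a : Fin n // a ∉ I} → Fin 2, ringSign n (mergeIdx (d := fun _ => 2) I x c) *
      ringSign n (mergeIdx (d := fun _ => 2) I y c) = 0 := by
  obtain ⟨h1, h2, h3, h4⟩ := fin_small_ne_zero hn
  obtain ⟨k, p, hkj, hkl, hpj, hpl, hkp⟩ := exists_neighbour_avoiding h1 h2 h3 h4 j l
  have hk : k ∉ I := by simp [hI, hkj, hkl]
  have hp : p ∉ I := by simp [hI, hpj, hpl]
  have hj : j ∈ I := by simp [hI]
  refine Finset.sum_involution (fun c _ => flipBit ⟨k, hk⟩ c) (fun c _ => ?_)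
    (fun c _ _ => flipBit_ne _ c) (fun _ _ => Finset.mem_univ _) (fun c _ => flipBit_flipBit _ c)
  rw [mergeIdx_flipBit, mergeIdx_flipBit]
  set f := mergeIdx (d := fun _ => 2) I x c with hf
  set g := mergeIdx (d := fun _ => 2) I y c with hg
  have hfgp : f p = g p := by simp [hf, hg, mergeIdx, hp]
  have hfgj : f j ≠ g j := by simpa [hf, hg, mergeIdx, hj] using hxy hj
  have hz : ∀ q : Fin 2, PauliZ q q * PauliZ q q = 1 := by
    intro q; fin_cases q <;> simp [PauliZ]
  have hz' : ∀ q r : Fin 2, q ≠ r → PauliZ q q * PauliZ r r = -1 := by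
    intro q r; fin_cases q <;> fin_cases r <;> simp [PauliZ]
  have hprod : ringSign n f * ringSign n (flipBit k f) *
      (ringSign n g * ringSign n (flipBit k g)) = -1 := by
    rw [ringSign_mul_ringSign_flipBit hn, ringSign_mul_ringSign_flipBit hn]
    have e : PauliZ (f j) (f j) * PauliZ (f p) (f p) *
        (PauliZ (g j) (g j) * PauliZ (g p) (g p)) = -1 := by
      rw [mul_mul_mul_comm, hfgp, hz, hz' _ _ hfgj, mul_one]
    rcases hkp with ⟨h, h'⟩ | ⟨h, h'⟩
    · rw [h, h', e]
    · rw [h, h', ← e]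
      ring
  linear_combination ringSign n f * ringSign n g * hprod -
    ringSign n (flipBit k f) * ringSign n (flipBit k g) * ringSign n g * ringSign n g *
      ringSign_mul_self n f -
    ringSign n (flipBit k f) * ringSign n (flipBit k g) * ringSign_mul_self n g

lemma ptraceOnto_ringGraphState {n : ℕ} [NeZero n] (hn : 5 ≤ n) (j l : Fin n) (hjl : j ≠ l) :
    ptraceOnto (d := fun _ => 2) ({j, l} : Finset (Fin n)) (ringGraphState n) =
      ((4 : ℂ))⁻¹ • 1 := by
  ext x y
  simp only [ptraceOnto, ringGraphState_apply hn, ← Finset.mul_sum]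
  by_cases h : x = y
  · subst h
    have hcard : Fintype.card {a : Fin n // a ∉ ({j, l} : Finset (Fin n))} = n - 2 := by
      rw [Fintype.card_subtype_compl, Fintype.card_fin, Fintype.card_coe, Finset.card_pair hjl]
    simp only [ringSign_mul_self, Finset.sum_const, Finset.card_univ, Fintype.card_pi,
      Fintype.card_fin, Finset.prod_const, hcard, Matrix.smul_apply, Matrix.one_apply_eq]
    obtain ⟨m, rfl⟩ : ∃ m, n = m + 2 := ⟨n - 2, by omega⟩
    have h2 : (2 : ℂ) ^ m ≠ 0 := by positivity
    simp only [Nat.add_sub_cancel, nsmul_eq_mul, smul_eq_mul, mul_one]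
    push_cast
    rw [pow_add]
    field_simp
    norm_num
  · rw [Matrix.smul_apply, Matrix.one_apply_ne h, smul_zero]
    obtain ⟨⟨a, ha⟩, hne⟩ := Function.ne_iff.mp h
    rcases Finset.mem_insert.mp ha with rfl | hal
    · rw [sum_ringSign_mergeIdx_eq_zero hn (l := l) (by simp) x y fun _ => hne, mul_zero]
    · obtain rfl := Finset.mem_singleton.mp hal
      rw [sum_ringSign_mergeIdx_eq_zero hn (l := j) (by simp [or_comm]) x y fun _ => hne,
        mul_zero]

/-- For `n ≥ 5`, the ring graph state `ρ_n = 2^{-n} Π_i (I + g_i)` is a rank-one orthogonal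
projection (`ρ_n² = ρ_n`, `ρ_n` Hermitian, `trace ρ_n = 1`, so `ρ_n = |ψ_n⟩⟨ψ_n|` is a pure
state), and every two-qubit reduced density operator of `ρ_n` is the maximally mixed state
`I₄/4`. -/
theorem ringGraphState_pure_and_two_qubit_marginals_maximally_mixed
    (n : ℕ) [NeZero n] (hn : 5 ≤ n) :
    (ringGraphState n * ringGraphState n = ringGraphState n ∧
      (ringGraphState n).IsHermitian ∧ (ringGraphState n).trace = 1) ∧
    (∀ j l : Fin n, j ≠ l →
      ptraceOnto (d := fun _ => 2) ({j, l} : Finset (Fin n)) (ringGraphState n) =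
        ((4 : ℂ))⁻¹ • 1) := by
  exact ⟨⟨ringGraphState_mul_self hn, ringGraphState_isHermitian hn, trace_ringGraphState hn⟩,
    ptraceOnto_ringGraphState hn⟩
end

section
/- Let n and k be positive integers with k ≤ n. Then there exists a density operator ρ on the n-qubit space (ℂ²)^{⊗n} such that for every subset T ⊆ {1,…,n} of size k, the partial trace of ρ over the qubits not in T equals 2^{−k} I (the maximally mixed state on k qubits), and rank ρ ≤ ⌊ √( C(n,k) · 4^k ) ⌋, where C(n,k) is the binomial coefficient. -/
open Matrix ComplexOrder

/-- A nonzero Hermitian matrix `H` of size `r + 1` has a real multiple with `1 - t • H` positive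
semidefinite and singular; such a matrix factors through dimension `r`. -/
theorem Matrix.IsHermitian.exists_one_sub_smul_eq_conjTranspose_mul_self {r : ℕ}
    {H : Matrix (Fin (r + 1)) (Fin (r + 1)) ℂ} (hH : H.IsHermitian) (h0 : H ≠ 0) :
    ∃ (t : ℂ) (C : Matrix (Fin r) (Fin (r + 1)) ℂ), 1 - t • H = Cᴴ * C := by
  obtain ⟨i₀, -, hmax⟩ := Finset.exists_max_image Finset.univ (fun i => |hH.eigenvalues i|)
    Finset.univ_nonempty
  set v := hH.eigenvalues with hv
  have hne : v i₀ ≠ 0 := by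
    intro h
    refine h0 (hH.eigenvalues_eq_zero_iff.mp (funext fun i => ?_))
    have := hmax i (Finset.mem_univ i)
    rw [h, abs_zero] at this
    exact abs_nonpos_iff.mp this
  have hnonneg (i) : 0 ≤ 1 - v i / v i₀ := by
    have h1 : v i / v i₀ ≤ |v i| / |v i₀| := (le_abs_self _).trans_eq (abs_div _ _)
    have h2 : |v i| / |v i₀| ≤ 1 := (div_le_one (abs_pos.mpr hne)).mpr (hmax i (Finset.mem_univ i))
    linarith
  let U : Matrix (Fin (r + 1)) (Fin (r + 1)) ℂ := hH.eigenvectorUnitary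
  have hUU : U * Uᴴ = 1 := Unitary.coe_mul_star_self hH.eigenvectorUnitary
  have hspec : H = U * diagonal (fun i => (v i : ℂ)) * Uᴴ := by
    conv_lhs => rw [hH.spectral_theorem]
    rfl
  refine ⟨((v i₀)⁻¹ : ℝ), of fun j a =>
    ((√(1 - v (i₀.succAbove j) / v i₀) : ℝ) : ℂ) * star (U a (i₀.succAbove j)), ?_⟩
  have hsplit : 1 - (((v i₀)⁻¹ : ℝ) : ℂ) • H
      = U * diagonal (fun i => ((1 - v i / v i₀ : ℝ) : ℂ)) * Uᴴ := by
    have hd : diagonal (fun i => ((1 - v i / v i₀ : ℝ) : ℂ))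
        = 1 - (((v i₀)⁻¹ : ℝ) : ℂ) • diagonal (fun i => (v i : ℂ)) := by
      ext i j
      by_cases hij : i = j
      · subst hij
        simp [div_eq_mul_inv, mul_comm]
      · simp [hij]
    conv_lhs => rw [hspec]
    rw [hd, mul_sub, sub_mul, mul_one, hUU, mul_smul_comm, smul_mul_assoc]
  rw [hsplit]
  ext a b
  rw [mul_apply, mul_apply, Fin.sum_univ_succAbove _ i₀]
  simp only [mul_diagonal, conjTranspose_apply, of_apply, div_self hne, sub_self,
    Complex.ofReal_zero, mul_zero, zero_mul, zero_add]
  refine Finset.sum_congr rfl fun j _ => ?_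
  have hs := congrArg (fun x : ℝ => (x : ℂ)) (Real.mul_self_sqrt (hnonneg (i₀.succAbove j)))
  simp only [Complex.ofReal_mul] at hs
  rw [← hs, star_mul', star_star, Complex.star_def, Complex.conj_ofReal]
  ring

/-- If the dimension of the codomain is too small, a linear map on square matrices whose kernel is
closed under conjugate transposition kills a nonzero Hermitian matrix. -/
theorem LinearMap.exists_isHermitian_map_eq_zero {ι V : Type*} [Fintype ι]
    [AddCommGroup V] [Module ℂ V] [FiniteDimensional ℂ V] (L : Matrix ι ι ℂ →ₗ[ℂ] V)
    (hL : ∀ X, L X = 0 → L Xᴴ = 0) (hdim : Module.finrank ℂ V < Fintype.card ι ^ 2) :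
    ∃ H : Matrix ι ι ℂ, H.IsHermitian ∧ H ≠ 0 ∧ L H = 0 := by
  have hker : LinearMap.ker L ≠ ⊥ := by
    refine LinearMap.ker_ne_bot_of_finrank_lt ?_
    rwa [Module.finrank_matrix, Module.finrank_self, mul_one, ← sq]
  obtain ⟨X, hX, hX0⟩ := (Submodule.ne_bot_iff _).mp hker
  rw [LinearMap.mem_ker] at hX
  by_cases h : X + Xᴴ = 0
  · refine ⟨Complex.I • X, ?_, smul_ne_zero Complex.I_ne_zero hX0, by rw [map_smul, hX, smul_zero]⟩
    rw [IsHermitian, conjTranspose_smul, eq_neg_of_add_eq_zero_right h]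
    simp
  · exact ⟨X + Xᴴ, isHermitian_add_transpose_self X, h, by rw [map_add, hX, hL X hX, add_zero]⟩

open scoped MatrixOrder in
/-- The Barvinok–Pataki rank bound for complex positive semidefinite matrices under linear
constraints. -/
theorem Matrix.PosSemidef.exists_rank_sq_le {N V : Type*} [Fintype N] [DecidableEq N]
    [AddCommGroup V] [Module ℂ V] [FiniteDimensional ℂ V] (L : Matrix N N ℂ →ₗ[ℂ] V)
    (hL : ∀ X, L X = 0 → L Xᴴ = 0) {M : Matrix N N ℂ} (hM : M.PosSemidef) :
    ∃ M' : Matrix N N ℂ, M'.PosSemidef ∧ L M' = L M ∧ M'.rank ^ 2 ≤ Module.finrank ℂ V := by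
  classical
  have hex : ∃ r, ∃ B : Matrix (Fin r) N ℂ, L (Bᴴ * B) = L M := by
    obtain ⟨B, hB⟩ := CStarAlgebra.nonneg_iff_eq_star_mul_self.mp hM.nonneg
    refine ⟨Fintype.card N, B.submatrix (Fintype.equivFin N).symm id, ?_⟩
    rw [conjTranspose_submatrix, submatrix_mul_equiv, submatrix_id_id, hB, star_eq_conjTranspose]
  obtain ⟨B, hB⟩ := Nat.find_spec hex
  have hmin := fun m => Nat.find_min hex (m := m)
  generalize Nat.find hex = r at B hB hmin
  refine ⟨Bᴴ * B, posSemidef_conjTranspose_mul_self B, hB, ?_⟩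
  have hrank : (Bᴴ * B).rank ≤ r := by
    rw [rank_conjTranspose_mul_self]
    simpa using rank_le_card_height B
  refine (Nat.pow_le_pow_left hrank 2).trans (not_lt.mp fun hlt => ?_)
  obtain _ | r := r
  · simp at hlt
  let Φ : Matrix (Fin (r + 1)) (Fin (r + 1)) ℂ →ₗ[ℂ] Matrix N N ℂ :=
    { toFun := fun X => Bᴴ * X * B
      map_add' := fun X Y => by rw [Matrix.mul_add, Matrix.add_mul]
      map_smul' := fun c X => by simp }
  obtain ⟨H, hH, hH0, hLH⟩ := (L ∘ₗ Φ).exists_isHermitian_map_eq_zero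
    (fun X hX => by
      have := hL _ hX
      simpa [Φ, Matrix.mul_assoc] using this) (by simpa using hlt)
  obtain ⟨t, C, hC⟩ := hH.exists_one_sub_smul_eq_conjTranspose_mul_self hH0
  refine hmin r (Nat.lt_succ_self r) ⟨C * B, ?_⟩
  have hCB : (C * B)ᴴ * (C * B) = Bᴴ * B - t • Φ H := by
    calc (C * B)ᴴ * (C * B) = Bᴴ * (Cᴴ * C) * B := by
          simp only [conjTranspose_mul, Matrix.mul_assoc]
      _ = Bᴴ * B - t • Φ H := by
          rw [← hC]
          simp [Φ, Matrix.mul_sub, Matrix.sub_mul]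
  have hΦ : L (Φ H) = 0 := hLH
  rw [hCB, map_sub, map_smul, hΦ, smul_zero, sub_zero, hB]

section PartialTrace

variable {n : ℕ} {d : Fin n → ℕ} (I : Finset (Fin n))

/-- `ptraceOnto` as a linear map. -/
noncomputable def ptraceOntoLinear :
    Matrix (∀ a, Fin (d a)) (∀ a, Fin (d a)) ℂ →ₗ[ℂ]
      Matrix (∀ a : {a : Fin n // a ∈ I}, Fin (d a.1))
        (∀ a : {a : Fin n // a ∈ I}, Fin (d a.1)) ℂ where
  toFun := ptraceOnto I
  map_add' X Y := by
    ext x y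
    simp [ptraceOnto, Finset.sum_add_distrib]
  map_smul' c X := by
    ext x y
    simp [ptraceOnto, Finset.mul_sum]

theorem ptraceOnto_conjTranspose (M : Matrix (∀ a, Fin (d a)) (∀ a, Fin (d a)) ℂ) :
    ptraceOnto I Mᴴ = (ptraceOnto I M)ᴴ := by
  ext x y
  simp [ptraceOnto, conjTranspose_apply]

theorem trace_ptraceOnto (M : Matrix (∀ a, Fin (d a)) (∀ a, Fin (d a)) ℂ) :
    (ptraceOnto I M).trace = M.trace := by
  simp only [trace, diag_apply, ptraceOnto]
  rw [← Fintype.sum_prod_type']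
  exact (Equiv.piEquivPiSubtypeProd (· ∈ I) fun a => Fin (d a)).symm.sum_comp fun z => M z z

theorem mergeIdx_left_inj {x y : ∀ a : {a : Fin n // a ∈ I}, Fin (d a.1)}
    {c : ∀ a : {a : Fin n // a ∉ I}, Fin (d a.1)} :
    mergeIdx I x c = mergeIdx I y c ↔ x = y := by
  refine ⟨fun h => funext fun a => ?_, fun h => by rw [h]⟩
  simpa [mergeIdx, a.2] using congrFun h a.1

theorem ptraceOnto_one :
    ptraceOnto I (1 : Matrix (∀ a, Fin (d a)) (∀ a, Fin (d a)) ℂ)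
      = (∏ a : {a : Fin n // a ∉ I}, (d a.1 : ℂ)) • 1 := by
  ext x y
  simp [ptraceOnto, one_apply, mergeIdx_left_inj]

end PartialTrace

/-- For `0 < k ≤ n` there is a density operator `ρ` on `n` qubits all of whose `k`-qubit
reduced density operators are maximally mixed (`2^{-k} I`), and with
`rank ρ ≤ ⌊√(C(n,k) · 4^k)⌋`. -/
theorem exists_low_rank_state_with_maximally_mixed_k_marginals
    (n k : ℕ) (hn : 0 < n) (hk : 0 < k) (hkn : k ≤ n) :
    ∃ ρ : Matrix (Fin n → Fin 2) (Fin n → Fin 2) ℂ,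
      (ρ.PosSemidef ∧ ρ.trace = 1) ∧
      (∀ T : Finset (Fin n), T.card = k →
        ptraceOnto (d := fun _ => 2) T ρ = ((2 : ℂ) ^ k)⁻¹ • 1) ∧
      ρ.rank ≤ Nat.sqrt (Nat.choose n k * 4 ^ k) := by
  let L : Matrix (Fin n → Fin 2) (Fin n → Fin 2) ℂ →ₗ[ℂ]
      (∀ T : Finset.powersetCard k (Finset.univ : Finset (Fin n)),
        Matrix ({a // a ∈ T.1} → Fin 2) ({a // a ∈ T.1} → Fin 2) ℂ) :=
    LinearMap.pi fun T => ptraceOntoLinear (d := fun _ => 2) T.1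
  have hL : ∀ X, L X = 0 → L Xᴴ = 0 := fun X hX => funext fun T => by
    have hT : ptraceOnto (d := fun _ => 2) T.1 X = 0 := congrFun hX T
    exact (ptraceOnto_conjTranspose (d := fun _ => 2) T.1 X).trans
      (by rw [hT, conjTranspose_zero]; rfl)
  have hM : (((2 : ℂ) ^ n)⁻¹ • (1 : Matrix (Fin n → Fin 2) (Fin n → Fin 2) ℂ)).PosSemidef :=
    PosSemidef.one.smul (by positivity)
  obtain ⟨ρ, hρ, hLρ, hrank⟩ := hM.exists_rank_sq_le L hL
  have hmarg : ∀ T : Finset (Fin n), T.card = k →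
      ptraceOnto (d := fun _ => 2) T ρ = ((2 : ℂ) ^ k)⁻¹ • 1 := fun T hT => by
    have h1 : ptraceOntoLinear (d := fun _ => 2) T ρ
        = ptraceOntoLinear (d := fun _ => 2) T (((2 : ℂ) ^ n)⁻¹ • 1) :=
      congrFun hLρ ⟨T, Finset.mem_powersetCard_univ.mpr hT⟩
    rw [map_smul] at h1
    refine h1.trans ?_
    change ((2 : ℂ) ^ n)⁻¹ • ptraceOnto (d := fun _ => 2) T 1 = _
    rw [ptraceOnto_one, smul_smul, Finset.prod_const, Finset.card_univ,
      Fintype.card_subtype_compl, Fintype.card_fin, Fintype.card_coe, hT]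
    congr 1
    rw [Nat.cast_ofNat, ← Nat.sub_add_cancel hkn, pow_add, Nat.add_sub_cancel]
    field_simp
  refine ⟨ρ, ⟨hρ, ?_⟩, hmarg, ?_⟩
  · obtain ⟨T, -, hT⟩ := Finset.exists_subset_card_eq
      (s := (Finset.univ : Finset (Fin n))) (n := k) (by simpa using hkn)
    rw [← trace_ptraceOnto (d := fun _ => 2) T ρ, hmarg T hT, trace_smul, trace_one]
    simp [hT]
  · rw [Nat.le_sqrt']
    refine hrank.trans_eq ?_
    rw [Module.finrank_pi_fintype, Finset.sum_congr rfl (g := fun _ => 4 ^ k)]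
    · simp
    · rintro ⟨T, hT⟩ -
      rw [Finset.mem_powersetCard_univ] at hT
      simp [Module.finrank_matrix, hT, ← mul_pow]
end
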